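/- Let G be a rainbow C_4-saturated graph with vertex set V, let D ⊆ V be a dominating set, and fix v ∈ D. For a connected component C of G[V∖D], let f(C) be the number of edges of G with at least one endpoint in V(C); call C sparse if f(C) = 2|V(C)| − 1. Let L be the set of vertices that lie in some sparse component and have degree exactly 2 in G. Then among the connected components of G[N(v)∖D] that contain a vertex of L, at most two have fewer than 3 vertices. -/

import Mathlib

/-- A proper edge-coloring: any two distinct edges of `G` sharing a vertex
receive different colors. -/
def ProperEdgeColoring {V : Type*} (G : SimpleGraph V) (c : Sym2 V → ℕ) : Prop :=
  ∀ e₁ ∈ G.edgeSet, ∀ e₂ ∈ G.edgeSet, e₁ ≠ e₂ → (∃ v, v ∈ e₁ ∧ v ∈ e₂) → c e₁ ≠ c e₂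

/-- `G` contains a rainbow copy of the cycle `C_k` under the edge-coloring `c`:
there are `k` distinct vertices, cyclically consecutive ones adjacent, whose
`k` cycle edges receive pairwise distinct colors. -/
def HasRainbowCycle {V : Type*} (G : SimpleGraph V) (c : Sym2 V → ℕ) (k : ℕ) : Prop :=
  ∃ f : ZMod k → V, Function.Injective f ∧ (∀ i, G.Adj (f i) (f (i + 1))) ∧
    Function.Injective (fun i : ZMod k => c s(f i, f (i + 1)))

/-- `G` is (properly) rainbow `C_k`-saturated: some proper edge-coloring of `G`
has no rainbow `C_k`-copy, but for every pair of nonadjacent vertices `x, y`,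
every proper edge-coloring of `G + xy` contains a rainbow `C_k`-copy. -/
def RainbowSat {V : Type*} (G : SimpleGraph V) (k : ℕ) : Prop :=
  (∃ c, ProperEdgeColoring G c ∧ ¬ HasRainbowCycle G c k) ∧
  ∀ x y : V, x ≠ y → ¬ G.Adj x y →
    ∀ c, ProperEdgeColoring (G ⊔ SimpleGraph.fromEdgeSet {s(x, y)}) c →
      HasRainbowCycle (G ⊔ SimpleGraph.fromEdgeSet {s(x, y)}) c k

/-- The subgraph of `G` on the same vertex set keeping only the edges with both
endpoints in `A` (used to model the induced subgraph `G[A]`). -/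
def restrictTo {V : Type*} (G : SimpleGraph V) (A : Set V) : SimpleGraph V :=
  SimpleGraph.fromRel (fun x y => G.Adj x y ∧ x ∈ A ∧ y ∈ A)

/-- The vertex set of the connected component of `x` in the graph `H`. -/
def compOf {V : Type*} (H : SimpleGraph V) (x : V) : Set V := {y | H.Reachable x y}

/-- `f(C)`: the number of edges of `G` with at least one endpoint in `C`. -/
noncomputable def edgesTouching {V : Type*} (G : SimpleGraph V) (C : Set V) : ℕ :=
  {e | e ∈ G.edgeSet ∧ ∃ w ∈ C, w ∈ e}.ncard

/-- A component `C` of `G[V ∖ D]` is sparse if `f(C) = 2|V(C)| − 1`. -/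
def SparseComp {V : Type*} (G : SimpleGraph V) (C : Set V) : Prop :=
  edgesTouching G C + 1 = 2 * C.ncard

/-- `L`: the set of vertices lying in some sparse component of `G[V ∖ D]` that
have degree exactly 2 in `G`. -/
def Lset {V : Type*} (G : SimpleGraph V) (D : Set V) : Set V :=
  {w | w ∉ D ∧ SparseComp G (compOf (restrictTo G Dᶜ) w) ∧ (G.neighborSet w).ncard = 2}

lemma sym2_ne {α : Type*} {a b c d : α} (h : (a ≠ c ∨ b ≠ d) ∧ (a ≠ d ∨ b ≠ c)) :
    s(a, b) ≠ s(c, d) := by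
  rw [Ne, Sym2.eq_iff]
  tauto

/-- A proper edge-coloring in which every 4-cycle has two opposite edges of the same color. -/
def IsGoodColoring {V : Type*} (G : SimpleGraph V) (c : Sym2 V → ℕ) : Prop :=
  (∀ x y z, G.Adj x y → G.Adj x z → y ≠ z → c s(x, y) ≠ c s(x, z)) ∧
  ∀ p q r t, G.Adj p q → G.Adj q r → G.Adj r t → G.Adj t p → p ≠ r → q ≠ t →
    c s(p, q) = c s(r, t) ∨ c s(q, r) = c s(t, p)

lemma properEdgeColoring_iff {V : Type*} (G : SimpleGraph V) (c : Sym2 V → ℕ) :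
    ProperEdgeColoring G c ↔
      ∀ x y z, G.Adj x y → G.Adj x z → y ≠ z → c s(x, y) ≠ c s(x, z) := by
  constructor
  · intro h x y z hy hz hyz
    refine h _ (by simpa using hy) _ (by simpa using hz) ?_ ⟨x, by simp, by simp⟩
    rwa [Ne, Sym2.congr_right]
  · rintro h e₁ h₁ e₂ h₂ hne ⟨v, hv₁, hv₂⟩
    obtain ⟨y, rfl⟩ := Sym2.mem_iff_exists.1 hv₁
    obtain ⟨z, rfl⟩ := Sym2.mem_iff_exists.1 hv₂
    exact h v y z h₁ h₂ (by rintro rfl; exact hne rfl)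

lemma hasRainbowCycle_four {V : Type*} (G : SimpleGraph V) (c : Sym2 V → ℕ) :
    HasRainbowCycle G c 4 ↔ ∃ p q r t, [p, q, r, t].Nodup ∧
      (G.Adj p q ∧ G.Adj q r ∧ G.Adj r t ∧ G.Adj t p) ∧
      [c s(p, q), c s(q, r), c s(r, t), c s(t, p)].Nodup := by
  constructor
  · rintro ⟨f, hf, hadj, hc⟩
    have e1 : (0 : ZMod 4) + 1 = 1 := by decide
    have e2 : (1 : ZMod 4) + 1 = 2 := by decide
    have e3 : (2 : ZMod 4) + 1 = 3 := by decide
    have e4 : (3 : ZMod 4) + 1 = 0 := by decide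
    refine ⟨f 0, f 1, f 2, f 3, ?_, ⟨e1 ▸ hadj 0, e2 ▸ hadj 1, e3 ▸ hadj 2, e4 ▸ hadj 3⟩, ?_⟩
    · exact List.Nodup.map hf (show [(0 : ZMod 4), 1, 2, 3].Nodup by decide)
    · have := List.Nodup.map hc (show [(0 : ZMod 4), 1, 2, 3].Nodup by decide)
      simpa only [List.map, e1, e2, e3, e4] using this
  · rintro ⟨p, q, r, t, hn, ⟨h1, h2, h3, h4⟩, hc⟩
    let g : ZMod 4 → V := (![p, q, r, t] : Fin 4 → V)
    refine ⟨g, ?_, ?_, ?_⟩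
    · exact (List.nodup_ofFn (f := (![p, q, r, t] : Fin 4 → V))).1
        (by simpa [List.ofFn_succ] using hn)
    · intro i
      change Fin 4 at i
      fin_cases i
      exacts [h1, h2, h3, h4]
    · have : (fun i : ZMod 4 => c s(g i, g (i + 1))) =
          (![c s(p, q), c s(q, r), c s(r, t), c s(t, p)] : Fin 4 → ℕ) := by
        funext i
        change Fin 4 at i
        fin_cases i <;> rfl
      rw [this]
      exact List.nodup_ofFn.1 (by simpa [List.ofFn_succ] using hc)

lemma isGoodColoring_iff {V : Type*} (G : SimpleGraph V) (c : Sym2 V → ℕ) :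
    IsGoodColoring G c ↔ ProperEdgeColoring G c ∧ ¬ HasRainbowCycle G c 4 := by
  rw [properEdgeColoring_iff, hasRainbowCycle_four]
  constructor
  · rintro ⟨hp, hr⟩
    refine ⟨hp, ?_⟩
    rintro ⟨p, q, r, t, hn, ⟨h1, h2, h3, h4⟩, hc⟩
    simp only [List.nodup_cons, List.mem_cons, List.not_mem_nil] at hn hc
    have := hr p q r t h1 h2 h3 h4 (by tauto) (by tauto)
    tauto
  · rintro ⟨hp, hr⟩
    refine ⟨hp, fun p q r t h1 h2 h3 h4 hpr hqt => ?_⟩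
    by_contra! hne
    refine hr ⟨p, q, r, t, ?_, ⟨h1, h2, h3, h4⟩, ?_⟩
    · have := h1.ne
      have := h2.ne
      have := h3.ne
      have := h4.ne
      simp; tauto
    · have e1 := hp q p r h1.symm h2 hpr
      have e2 := hp r q t h2.symm h3 hqt
      have e3 := hp t r p h3.symm h4 hpr.symm
      have e4 := hp p t q h4.symm h1 hqt.symm
      rw [Sym2.eq_swap] at e1 e2 e3 e4
      simp only [List.nodup_cons, List.mem_cons, List.not_mem_nil]
      grind

lemma IsGoodColoring.mono {V : Type*} {G H : SimpleGraph V} {c : Sym2 V → ℕ} (hle : G ≤ H)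
    (h : IsGoodColoring H c) : IsGoodColoring G c :=
  ⟨fun x y z hy hz => h.1 x y z (hle hy) (hle hz),
    fun p q r t h1 h2 h3 h4 => h.2 p q r t (hle h1) (hle h2) (hle h3) (hle h4)⟩

open Classical in
/-- Adding or recoloring a single edge `xy`. -/
lemma IsGoodColoring.update {V : Type*} {G : SimpleGraph V} {c : Sym2 V → ℕ}
    (h : IsGoodColoring G c) {x y : V} {k : ℕ}
    (hx : ∀ z, G.Adj x z → z ≠ y → k ≠ c s(x, z))
    (hy : ∀ z, G.Adj y z → z ≠ x → k ≠ c s(y, z))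
    (hxy : ∀ a b, G.Adj x a → G.Adj a b → G.Adj b y → a ≠ y → b ≠ x →
      k = c s(a, b) ∨ c s(x, a) = c s(b, y)) :
    IsGoodColoring (G ⊔ SimpleGraph.fromEdgeSet {s(x, y)}) (Function.update c s(x, y) k) := by
  have hadj : ∀ a b, (G ⊔ SimpleGraph.fromEdgeSet {s(x, y)}).Adj a b → s(a, b) ≠ s(x, y) →
      G.Adj a b := by
    intro a b hab hne
    simpa [hne] using hab
  have hprop : ∀ a b d, (G ⊔ SimpleGraph.fromEdgeSet {s(x, y)}).Adj a d → b ≠ d →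
      s(a, b) = s(x, y) → k ≠ c s(a, d) := by
    intro a b d had hbd he
    have hne : s(a, d) ≠ s(x, y) := by
      rwa [← he, Ne, Sym2.congr_right, eq_comm]
    have := hadj _ _ had hne
    rcases Sym2.eq_iff.1 he with ⟨rfl, rfl⟩ | ⟨rfl, rfl⟩
    · exact hx d this hbd.symm
    · exact hy d this hbd.symm
  have hcyc : ∀ p q r t, (G ⊔ SimpleGraph.fromEdgeSet {s(x, y)}).Adj p q →
      (G ⊔ SimpleGraph.fromEdgeSet {s(x, y)}).Adj q r →
      (G ⊔ SimpleGraph.fromEdgeSet {s(x, y)}).Adj r t →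
      (G ⊔ SimpleGraph.fromEdgeSet {s(x, y)}).Adj t p → p ≠ r → q ≠ t → s(p, q) = s(x, y) →
      Function.update c s(x, y) k s(p, q) = Function.update c s(x, y) k s(r, t) ∨
        Function.update c s(x, y) k s(q, r) = Function.update c s(x, y) k s(t, p) := by
    intro p q r t h1 h2 h3 h4 hpr hqt he
    have n2 : s(q, r) ≠ s(x, y) := he ▸ sym2_ne ⟨.inl h1.ne', .inr hpr.symm⟩
    have n3 : s(r, t) ≠ s(x, y) := he ▸ sym2_ne ⟨.inl hpr.symm, .inr h4.ne⟩
    have n4 : s(t, p) ≠ s(x, y) := he ▸ sym2_ne ⟨.inl h4.ne, .inl hqt.symm⟩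
    rw [Function.update_of_ne n2, Function.update_of_ne n3, Function.update_of_ne n4, he,
      Function.update_self]
    replace h2 := hadj _ _ h2 n2
    replace h3 := hadj _ _ h3 n3
    replace h4 := hadj _ _ h4 n4
    rcases Sym2.eq_iff.1 he with ⟨rfl, rfl⟩ | ⟨rfl, rfl⟩
    · rw [Sym2.eq_swap (a := r), Sym2.eq_swap (a := q), Sym2.eq_swap (a := t) (b := p)]
      exact (hxy t r h4.symm h3.symm h2.symm hqt.symm hpr.symm).imp id Eq.symm
    · exact hxy r t h2 h3 h4 hpr.symm hqt.symm
  refine ⟨fun a b d hab had hbd => ?_, fun p q r t h1 h2 h3 h4 hpr hqt => ?_⟩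
  · by_cases e1 : s(a, b) = s(x, y)
    · have e2 : s(a, d) ≠ s(x, y) := by
        rwa [← e1, Ne, Sym2.congr_right, eq_comm]
      rw [Function.update_of_ne e2, e1, Function.update_self]
      exact hprop a b d had hbd e1
    · rw [Function.update_of_ne e1]
      by_cases e2 : s(a, d) = s(x, y)
      · rw [e2, Function.update_self]
        exact (hprop a d b hab hbd.symm e2).symm
      · rw [Function.update_of_ne e2]
        exact h.1 a b d (hadj _ _ hab e1) (hadj _ _ had e2) hbd
  · by_cases e1 : s(p, q) = s(x, y)
    · exact hcyc p q r t h1 h2 h3 h4 hpr hqt e1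
    by_cases e2 : s(q, r) = s(x, y)
    · have := hcyc q r t p h2 h3 h4 h1 hqt hpr.symm e2
      tauto
    by_cases e3 : s(r, t) = s(x, y)
    · have := hcyc r t p q h3 h4 h1 h2 hpr.symm hqt.symm e3
      exact this.imp Eq.symm Eq.symm
    by_cases e4 : s(t, p) = s(x, y)
    · have := hcyc t p q r h4 h1 h2 h3 hqt.symm hpr e4
      exact this.symm.imp id Eq.symm
    rw [Function.update_of_ne e1, Function.update_of_ne e2, Function.update_of_ne e3,
      Function.update_of_ne e4]
    exact h.2 p q r t (hadj _ _ h1 e1) (hadj _ _ h2 e2) (hadj _ _ h3 e3) (hadj _ _ h4 e4) hpr hqt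

lemma exists_fresh_color {V : Type*} [Finite V] (c : Sym2 V → ℕ) : ∃ k, ∀ e, k ≠ c e := by
  obtain ⟨k, hk⟩ := (Set.finite_range c).exists_notMem
  exact ⟨k, fun e he => hk ⟨e, he.symm⟩⟩

/-- Let `w₁`, `w₂` be nonadjacent vertices of degree two with a common neighbor `v`, and let `uᵢ`
be the other neighbor of `wᵢ`. If `wᵢ` is the only common neighbor of `v` and `uᵢ` whenever these
are adjacent, then `u₁` and `u₂` are adjacent. -/
lemma RainbowSat.adj_of_degree_two {V : Type*} [Finite V] {G : SimpleGraph V}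
    (hG : RainbowSat G 4) {v w₁ w₂ u₁ u₂ : V} (hne : w₁ ≠ w₂) (hw : ¬ G.Adj w₁ w₂)
    (h₁ : ∀ z, G.Adj w₁ z ↔ z = v ∨ z = u₁) (h₂ : ∀ z, G.Adj w₂ z ↔ z = v ∨ z = u₂)
    (huv₁ : u₁ ≠ v) (huv₂ : u₂ ≠ v)
    (hc₁ : G.Adj v u₁ → ∀ z, G.Adj v z → G.Adj u₁ z → z = w₁)
    (hc₂ : G.Adj v u₂ → ∀ z, G.Adj v z → G.Adj u₂ z → z = w₂) :
    G.Adj u₁ u₂ := by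
  classical
  by_contra hu
  obtain ⟨⟨c, hc⟩, hsat⟩ := hG
  have hnot : ∀ d, ¬ IsGoodColoring (G ⊔ SimpleGraph.fromEdgeSet {s(w₁, w₂)}) d := by
    intro d hd
    rw [isGoodColoring_iff] at hd
    exact hd.2 (hsat w₁ w₂ hne hw d hd.1)
  rw [← isGoodColoring_iff] at hc
  have a1 : G.Adj w₁ v := (h₁ v).2 (Or.inl rfl)
  have a2 : G.Adj w₂ v := (h₂ v).2 (Or.inl rfl)
  have b1 : G.Adj w₁ u₁ := (h₁ u₁).2 (Or.inr rfl)
  have b2 : G.Adj w₂ u₂ := (h₂ u₂).2 (Or.inr rfl)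
  have main12 : ∀ {w₁ w₂ u₁ u₂ : V}, w₁ ≠ w₂ → ¬ G.Adj w₁ w₂ →
      (∀ z, G.Adj w₁ z ↔ z = v ∨ z = u₁) → (∀ z, G.Adj w₂ z ↔ z = v ∨ z = u₂) →
      G.Adj v u₁ → (∀ d, ¬ IsGoodColoring (G ⊔ SimpleGraph.fromEdgeSet {s(w₁, w₂)}) d) →
      ¬ G.Adj u₁ u₂ → ∀ d, IsGoodColoring G d → d s(v, u₁) ≠ d s(w₂, u₂) →
      (G.Adj v u₂ → d s(w₁, v) = d s(u₂, w₂)) → False := by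
    intro w₁ w₂ u₁ u₂ hne hw h₁ h₂ hvu hnot hu d hd hdne heq
    have a1 : G.Adj w₁ v := (h₁ v).2 (Or.inl rfl)
    have a2 : G.Adj w₂ v := (h₂ v).2 (Or.inl rfl)
    have b1 : G.Adj w₁ u₁ := (h₁ u₁).2 (Or.inr rfl)
    refine hnot _ (hd.update (k := d s(v, u₁)) ?_ ?_ ?_)
    · intro z hz _
      rcases (h₁ z).1 hz with rfl | rfl
      · have := hd.1 z u₁ w₁ hvu a1.symm b1.ne'
        rwa [Sym2.eq_swap (a := w₁)]
      · have := hd.1 z v w₁ hvu.symm b1.symm a1.ne'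
        rwa [Sym2.eq_swap (a := w₁), Sym2.eq_swap (a := v)]
    · intro z hz _
      rcases (h₂ z).1 hz with rfl | rfl
      · have := hd.1 z u₁ w₂ hvu a2.symm (by rintro rfl; exact hw b1)
        rwa [Sym2.eq_swap (a := w₂)]
      · exact hdne
    · intro a b ha hab hb _ _
      have hb' := (h₂ b).1 hb.symm
      rcases (h₁ a).1 ha with rfl | rfl
      · rcases hb' with rfl | rfl
        · exact (G.irrefl hab).elim
        · exact Or.inr (heq hab)
      · rcases hb' with rfl | rfl
        · exact Or.inl (by rw [Sym2.eq_swap])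
        · exact (hu hab).elim
  have main : ∀ {w₁ w₂ u₁ u₂ : V}, w₁ ≠ w₂ → ¬ G.Adj w₁ w₂ →
      (∀ z, G.Adj w₁ z ↔ z = v ∨ z = u₁) → (∀ z, G.Adj w₂ z ↔ z = v ∨ z = u₂) →
      G.Adj v u₁ → (∀ d, ¬ IsGoodColoring (G ⊔ SimpleGraph.fromEdgeSet {s(w₁, w₂)}) d) →
      ¬ G.Adj u₁ u₂ → u₂ ≠ v → ¬ G.Adj v u₂ → False := by
    intro w₁ w₂ u₁ u₂ hne hw h₁ h₂ hvu hnot hu huv₂ hvu₂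
    have b2 : G.Adj w₂ u₂ := (h₂ u₂).2 (Or.inr rfl)
    by_cases hdne : c s(v, u₁) = c s(w₂, u₂)
    · obtain ⟨k, hk⟩ := exists_fresh_color c
      have hd := hc.update (x := w₂) (y := u₂) (k := k) (fun _ _ _ => hk _) (fun _ _ _ => hk _) ?_
      · refine main12 hne hw h₁ h₂ hvu hnot hu _ (hd.mono le_sup_left) ?_ (fun h => (hvu₂ h).elim)
        rw [Function.update_self, Function.update_of_ne]
        · exact (hk _).symm
        · intro he
          rcases Sym2.eq_iff.1 he with ⟨_, rfl⟩ | ⟨rfl, _⟩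
          · exact hvu₂ hvu
          · exact huv₂ rfl
      · intro a b ha hab hb hau hbw
        rcases (h₂ a).1 ha with rfl | rfl
        · right
          refine (hc.2 w₂ a b u₂ ha hab hb b2.symm hbw.symm hau).resolve_right ?_
          intro he
          rw [Sym2.eq_swap (a := u₂), ← hdne] at he
          exact hc.1 a b u₁ hab hvu (by rintro rfl; exact hu hb) he
        · exact (hau rfl).elim
    · exact main12 hne hw h₁ h₂ hvu hnot hu c hc hdne (fun h => (hvu₂ h).elim)
  by_cases t1 : G.Adj v u₁ <;> by_cases t2 : G.Adj v u₂
  · obtain ⟨k, hk⟩ := exists_fresh_color c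
    have hd : IsGoodColoring G (Function.update c s(w₁, v) k) := by
      refine (hc.update (fun _ _ _ => hk _) (fun _ _ _ => hk _) ?_).mono le_sup_left
      intro a b ha hab hb hav hbw
      rcases (h₁ a).1 ha with rfl | rfl
      · exact (hav rfl).elim
      · exact (hbw (hc₁ t1 b hb.symm hab)).elim
    have hw2 : w₂ ≠ v := a2.ne
    have hu2w1 : u₂ ≠ w₁ := by rintro rfl; exact hw b2.symm
    have hd' : IsGoodColoring G (Function.update (Function.update c s(w₁, v) k) s(w₂, u₂) k) := by
      refine (hd.update ?_ ?_ ?_).mono le_sup_left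
      · intro z _ _
        rw [Function.update_of_ne (sym2_ne ⟨.inl hne.symm, .inl hw2⟩)]
        exact hk _
      · intro z _ _
        rw [Function.update_of_ne (sym2_ne ⟨.inl hu2w1, .inl huv₂⟩)]
        exact hk _
      · intro a b ha hab hb hau hbw
        rcases (h₂ a).1 ha with rfl | rfl
        · exact (hbw (hc₂ t2 b hab hb.symm)).elim
        · exact (hau rfl).elim
    have hw1v : s(w₁, v) ≠ s(w₂, u₂) := sym2_ne ⟨.inl hne, .inr hw2.symm⟩
    have e1 : s(v, u₁) ≠ s(w₂, u₂) := sym2_ne ⟨.inl hw2.symm, .inl huv₂.symm⟩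
    have e2 : s(v, u₁) ≠ s(w₁, v) := sym2_ne ⟨.inl a1.ne', .inr b1.ne'⟩
    refine main12 hne hw h₁ h₂ t1 hnot hu _ hd' ?_ (fun _ => ?_)
    · rw [Function.update_self, Function.update_of_ne e1, Function.update_of_ne e2]
      exact (hk _).symm
    · rw [Sym2.eq_swap (a := u₂), Function.update_self, Function.update_of_ne hw1v,
        Function.update_self]
  · exact main hne hw h₁ h₂ t1 hnot hu huv₂ t2
  · refine main hne.symm (fun h => hw h.symm) h₂ h₁ t2 ?_ (fun h => hu h.symm) huv₁ t1
    rwa [Sym2.eq_swap]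
  · obtain ⟨k, hk⟩ := exists_fresh_color c
    refine hnot _ (hc.update (fun _ _ _ => hk _) (fun _ _ _ => hk _) ?_)
    intro a b ha hab hb _ _
    rcases (h₁ a).1 ha with rfl | rfl <;> rcases (h₂ b).1 hb.symm with rfl | rfl
    · exact (G.irrefl hab).elim
    · exact (t2 hab).elim
    · exact (t1 hab.symm).elim
    · exact (hu hab).elim

lemma restrictTo_adj {V : Type*} {G : SimpleGraph V} {A : Set V} {x y : V} :
    (restrictTo G A).Adj x y ↔ G.Adj x y ∧ x ∈ A ∧ y ∈ A := by
  rw [restrictTo, SimpleGraph.fromRel_adj]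
  constructor
  · rintro ⟨-, h | h⟩
    · exact h
    · exact ⟨h.1.symm, h.2.2, h.2.1⟩
  · exact fun h => ⟨h.1.ne, Or.inl h⟩

lemma mem_compOf_self {V : Type*} (H : SimpleGraph V) (x : V) : x ∈ compOf H x :=
  SimpleGraph.Reachable.refl x

lemma mem_compOf_of_adj {V : Type*} {H : SimpleGraph V} {x y z : V} (hy : y ∈ compOf H x)
    (h : H.Adj y z) : z ∈ compOf H x :=
  SimpleGraph.Reachable.trans hy h.reachable

lemma compOf_eq_of_mem {V : Type*} {H : SimpleGraph V} {x y : V} (hy : y ∈ compOf H x) :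
    compOf H x = compOf H y := by
  ext z
  exact ⟨fun hz => (SimpleGraph.Reachable.symm hy).trans hz, fun hz => hy.trans hz⟩

lemma compOf_restrictTo_subset {V : Type*} {G : SimpleGraph V} {A : Set V} {x : V} (hx : x ∈ A) :
    compOf (restrictTo G A) x ⊆ A := by
  rintro y ⟨p⟩
  induction p with
  | nil => exact hx
  | cons h _ ih => exact ih (restrictTo_adj.1 h).2.2

/-- A sparse component induces a tree, and each of its vertices has a unique neighbor in the
dominating set. -/
lemma sparseComp_structure {V : Type*} [Finite V] {G : SimpleGraph V} {D : Set V}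
    (hD : ∀ v, v ∈ D ∨ ∃ u ∈ D, G.Adj u v) {w : V} (hw : w ∉ D)
    (hs : SparseComp G (compOf (restrictTo G Dᶜ) w)) :
    (∀ y ∈ compOf (restrictTo G Dᶜ) w, ∀ a ∈ D, ∀ b ∈ D, G.Adj y a → G.Adj y b → a = b) ∧
    (∀ x ∈ compOf (restrictTo G Dᶜ) w, ∀ y ∈ compOf (restrictTo G Dᶜ) w,
      ∀ z ∈ compOf (restrictTo G Dᶜ) w, G.Adj x y → G.Adj x z → ¬ G.Adj y z) := by
  classical
  set K := compOf (restrictTo G Dᶜ) w with hK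
  have hKD : ∀ y ∈ K, y ∉ D := fun y hy => compOf_restrictTo_subset (A := Dᶜ) hw hy
  have hsupp : K = ((restrictTo G Dᶜ).connectedComponentMk w).supp := by
    ext y
    rw [SimpleGraph.ConnectedComponent.mem_supp_iff, SimpleGraph.ConnectedComponent.eq]
    exact ⟨SimpleGraph.Reachable.symm, SimpleGraph.Reachable.symm⟩
  have hT : (G.induce K).Connected := by
    have h := ((restrictTo G Dᶜ).connectedComponentMk w).maximal_connected_induce_supp.prop
    rw [← hsupp] at h
    refine SimpleGraph.Connected.mono (fun a b hab => ?_) h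
    exact (restrictTo_adj.1 (SimpleGraph.induce_adj.1 hab)).1
  choose! d hd hdadj using fun y (hy : y ∈ K) => (hD y).resolve_left (hKD y hy)
  have hmap : Function.Injective (Sym2.map (Subtype.val : K → V)) :=
    Sym2.map.injective Subtype.val_injective
  let E₁ : Set (Sym2 V) := Sym2.map (Subtype.val : K → V) '' (G.induce K).edgeSet
  let E₂ : Set (Sym2 V) := (fun y => s(y, d y)) '' K
  have hE₁D : ∀ e ∈ E₁, ∀ a ∈ e, a ∉ D := by
    rintro _ ⟨e, -, rfl⟩ a ha
    obtain ⟨b, -, rfl⟩ := Sym2.mem_map.1 ha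
    exact hKD b b.2
  have hE₁ : E₁.ncard = Nat.card (G.induce K).edgeSet := Set.ncard_image_of_injective _ hmap
  have hE₂ : E₂.ncard = K.ncard := by
    refine Set.InjOn.ncard_image fun y hy z hz h => ?_
    rcases Sym2.eq_iff.1 h with ⟨h, -⟩ | ⟨h, -⟩
    · exact h
    · exact (hKD y hy (h ▸ hd z hz)).elim
  have hdisj : Disjoint E₁ E₂ := by
    rw [Set.disjoint_left]
    rintro _ h₁ ⟨y, hy, rfl⟩
    exact hE₁D _ h₁ (d y) (Sym2.mem_mk_right _ _) (hd y hy)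
  have hsub : E₁ ∪ E₂ ⊆ {e | e ∈ G.edgeSet ∧ ∃ w ∈ K, w ∈ e} := by
    rintro _ (⟨e, he, rfl⟩ | ⟨y, hy, rfl⟩)
    · induction e with
      | _ a b => exact ⟨he, a, a.2, Sym2.mem_mk_left _ _⟩
    · exact ⟨(hdadj y hy).symm, y, hy, Sym2.mem_mk_left _ _⟩
  have hcard := Set.ncard_union_eq hdisj
  have hle := Set.ncard_le_ncard hsub
  have htree := hT.card_vert_le_card_edgeSet_add_one
  have hKc : Nat.card K = K.ncard := rfl
  unfold SparseComp edgesTouching at hs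
  have heq := Set.eq_of_subset_of_ncard_le hsub (by omega)
  constructor
  · have huniq : ∀ y ∈ K, ∀ a ∈ D, G.Adj y a → a = d y := by
      intro y hy a ha hya
      have hmem : s(y, a) ∈ E₁ ∪ E₂ := by
        rw [heq]
        exact ⟨hya, y, hy, Sym2.mem_mk_left _ _⟩
      rcases hmem with h | ⟨z, hz, h⟩
      · exact (hE₁D _ h a (Sym2.mem_mk_right _ _) ha).elim
      · rcases Sym2.eq_iff.1 h with ⟨rfl, h'⟩ | ⟨h, -⟩
        · exact h'.symm
        · exact (hKD z hz (h ▸ ha)).elim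
    intro y hy a ha b hb hya hyb
    rw [huniq y hy a ha hya, huniq y hy b hb hyb]
  · intro x hx y hy z hz hxy hxz hyz
    have hac : (G.induce K).IsAcyclic :=
      (SimpleGraph.isTree_iff_connected_and_card.2 ⟨hT, by omega⟩).isAcyclic
    exact hac.cliqueFree le_rfl {(⟨x, hx⟩ : K), ⟨y, hy⟩, ⟨z, hz⟩}
      (SimpleGraph.is3Clique_triple_iff.2 ⟨SimpleGraph.induce_adj.2 hxy,
        SimpleGraph.induce_adj.2 hxz, SimpleGraph.induce_adj.2 hyz⟩)

/-- Claim 8, part 1: in a rainbow `C₄`-saturated graph `G` with dominating set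
`D` and `v ∈ D`, among the connected components of `G[N(v) ∖ D]` which contain a
vertex of `L`, at most two have fewer than 3 vertices. -/
theorem rainbow_sat_C4_small_L_components {V : Type*} [Fintype V] (G : SimpleGraph V)
    (hG : RainbowSat G 4) (D : Set V) (hD : ∀ v, v ∈ D ∨ ∃ u ∈ D, G.Adj u v)
    (v : V) (hv : v ∈ D) :
    {C : Set V | ∃ x, G.Adj v x ∧ x ∉ D ∧
        C = compOf (restrictTo G (G.neighborSet v \ D)) x ∧
        (∃ w ∈ C, w ∈ Lset G D) ∧ C.ncard < 3}.ncard ≤ 2 := by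
  rw [← not_lt, Set.two_lt_ncard_iff]
  rintro ⟨C₁, C₂, C₃, hC₁, hC₂, hC₃, h12, h13, h23⟩
  have key : ∀ C ∈ {C : Set V | ∃ x, G.Adj v x ∧ x ∉ D ∧
        C = compOf (restrictTo G (G.neighborSet v \ D)) x ∧
        (∃ w ∈ C, w ∈ Lset G D) ∧ C.ncard < 3},
      ∃ w u, C = compOf (restrictTo G (G.neighborSet v \ D)) w ∧ G.Adj v w ∧ w ∉ D ∧ u ∉ D ∧
        SparseComp G (compOf (restrictTo G Dᶜ) w) ∧ (∀ z, G.Adj w z ↔ z = v ∨ z = u) ∧ u ≠ v ∧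
        (G.Adj v u → ∀ z, G.Adj v z → G.Adj u z → z = w) := by
    rintro C ⟨x, hvx, hxD, rfl, ⟨w, hwC, hwD, hws, hw2⟩, hcard⟩
    have hvw : G.Adj v w := 
      (compOf_restrictTo_subset (A := G.neighborSet v \ D) ⟨hvx, hxD⟩ hwC).1
    obtain ⟨hD1, -⟩ := sparseComp_structure hD hwD hws
    rw [compOf_eq_of_mem hwC] at hcard ⊢
    have hu : ∃ u, u ≠ v ∧ ∀ z, G.Adj w z ↔ z = v ∨ z = u := by
      obtain ⟨a, b, hab, hN⟩ := Set.ncard_eq_two.1 hw2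
      have hN' : ∀ z, G.Adj w z ↔ z = a ∨ z = b := fun z => by
        rw [← SimpleGraph.mem_neighborSet, hN]; simp
      rcases (hN' v).1 hvw.symm with rfl | rfl
      · exact ⟨b, hab.symm, hN'⟩
      · exact ⟨a, hab, fun z => (hN' z).trans or_comm⟩
    obtain ⟨u, huv, hN⟩ := hu
    have hwu : G.Adj w u := (hN u).2 (Or.inr rfl)
    have huD : u ∉ D := fun huD =>
      huv (hD1 w (mem_compOf_self _ _) u huD v hv hwu hvw.symm)
    refine ⟨w, u, rfl, hvw, hwD, huD, hws, hN, huv, fun hvu z hvz huz => ?_⟩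
    by_contra hzw
    have hzD : z ∉ D := fun hzD => hvz.ne
      (hD1 u (mem_compOf_of_adj (mem_compOf_self _ _) (restrictTo_adj.2 ⟨hwu, hwD, huD⟩))
        v hv z hzD hvu.symm huz)
    have hu' := mem_compOf_of_adj (mem_compOf_self (restrictTo G (G.neighborSet v \ D)) w)
      (restrictTo_adj.2 ⟨hwu, ⟨hvw, hwD⟩, ⟨hvu, huD⟩⟩)
    have hz' := mem_compOf_of_adj hu' (restrictTo_adj.2 ⟨huz, ⟨hvu, huD⟩, ⟨hvz, hzD⟩⟩)
    refine absurd ((Set.two_lt_ncard_iff (Set.toFinite _)).2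
      ⟨w, u, z, mem_compOf_self _ _, hu', hz', hwu.ne, Ne.symm hzw, huz.ne⟩) ?_
    omega
  have adj : ∀ {w₁ w₂ u₁ u₂ : V}, compOf (restrictTo G (G.neighborSet v \ D)) w₁ ≠
      compOf (restrictTo G (G.neighborSet v \ D)) w₂ → G.Adj v w₁ → w₁ ∉ D → G.Adj v w₂ →
      w₂ ∉ D → (∀ z, G.Adj w₁ z ↔ z = v ∨ z = u₁) → (∀ z, G.Adj w₂ z ↔ z = v ∨ z = u₂) →
      u₁ ≠ v → u₂ ≠ v → (G.Adj v u₁ → ∀ z, G.Adj v z → G.Adj u₁ z → z = w₁) →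
      (G.Adj v u₂ → ∀ z, G.Adj v z → G.Adj u₂ z → z = w₂) → G.Adj u₁ u₂ := by
    intro w₁ w₂ u₁ u₂ hne hv₁ hw₁ hv₂ hw₂ hN₁ hN₂ hu₁ hu₂ hc₁ hc₂
    refine hG.adj_of_degree_two (by rintro rfl; exact hne rfl) (fun h => hne ?_) hN₁ hN₂ hu₁ hu₂ hc₁ hc₂
    exact compOf_eq_of_mem (mem_compOf_of_adj (mem_compOf_self _ _)
      (restrictTo_adj.2 ⟨h, ⟨hv₁, hw₁⟩, ⟨hv₂, hw₂⟩⟩))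
  obtain ⟨w₁, u₁, rfl, hv₁, hw₁, hd₁, hs₁, hN₁, hu₁, hc₁⟩ := key C₁ hC₁
  obtain ⟨w₂, u₂, rfl, hv₂, hw₂, hd₂, -, hN₂, hu₂, hc₂⟩ := key C₂ hC₂
  obtain ⟨w₃, u₃, rfl, hv₃, hw₃, hd₃, -, hN₃, hu₃, hc₃⟩ := key C₃ hC₃
  have a12 := adj h12 hv₁ hw₁ hv₂ hw₂ hN₁ hN₂ hu₁ hu₂ hc₁ hc₂
  have a13 := adj h13 hv₁ hw₁ hv₃ hw₃ hN₁ hN₃ hu₁ hu₃ hc₁ hc₃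
  have a23 := adj h23 hv₂ hw₂ hv₃ hw₃ hN₂ hN₃ hu₂ hu₃ hc₂ hc₃
  have m1 := mem_compOf_of_adj (mem_compOf_self (restrictTo G Dᶜ) w₁)
    (restrictTo_adj.2 ⟨(hN₁ u₁).2 (Or.inr rfl), hw₁, hd₁⟩)
  have m2 := mem_compOf_of_adj m1 (restrictTo_adj.2 ⟨a12, hd₁, hd₂⟩)
  have m3 := mem_compOf_of_adj m1 (restrictTo_adj.2 ⟨a13, hd₁, hd₃⟩)
  exact (sparseComp_structure hD hw₁ hs₁).2 u₁ m1 u₂ m2 u₃ m3 a12 a13 a23
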